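/- arXiv:2605.25576 — 5 statements merged into one kernel-verified Lean document; each statement's English description precedes it below -/
import Mathlib

section
/- Let (l, ∘) be a left Leibniz algebra over a field k of characteristic 0, i.e. a k-vector space with a bilinear operation ∘ satisfying x ∘ (y ∘ z) = (x ∘ y) ∘ z + y ∘ (x ∘ z) for all x, y, z ∈ l. Define [x, y] := x ∘ y − y ∘ x and ⟦x, y, z⟧ := −(x ∘ y) ∘ z. Then (l, [·,·], ⟦·,·,·⟧) is a Lie-Yamaguti algebra; in particular [·,·] is skew-symmetric and ⟦·,·,·⟧ is skew-symmetric in its first two arguments. -/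
/-- The operator `D_{ρ,μ}(x,y) = ρ_x∘ρ_y − ρ_y∘ρ_x − ρ_{[x,y]} − μ(x,y) + μ(y,x)`. -/
def Dop {G V : Type*} [AddCommGroup V]
    (br : G → G → G) (ρ : G → V → V) (μ : G → G → V → V) (x y : G) (v : V) : V :=
  ρ x (ρ y v) - ρ y (ρ x v) - ρ (br x y) v - μ x y v + μ y x v

/-- A Lie-Yamaguti algebra structure on a `k`-vector space `G`, given by a bilinear
binary bracket `br` and a trilinear ternary bracket `tr`. -/
structure IsLieYamaguti (k G : Type*) [Field k] [CharZero k]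
    [AddCommGroup G] [Module k G] (br : G → G → G) (tr : G → G → G → G) : Prop where
  br_add_left : ∀ x y z : G, br (x + y) z = br x z + br y z
  br_smul_left : ∀ (c : k) (x y : G), br (c • x) y = c • br x y
  br_add_right : ∀ x y z : G, br x (y + z) = br x y + br x z
  br_smul_right : ∀ (c : k) (x y : G), br x (c • y) = c • br x y
  tr_add₁ : ∀ x x' y z : G, tr (x + x') y z = tr x y z + tr x' y z
  tr_smul₁ : ∀ (c : k) (x y z : G), tr (c • x) y z = c • tr x y z
  tr_add₂ : ∀ x y y' z : G, tr x (y + y') z = tr x y z + tr x y' z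
  tr_smul₂ : ∀ (c : k) (x y z : G), tr x (c • y) z = c • tr x y z
  tr_add₃ : ∀ x y z z' : G, tr x y (z + z') = tr x y z + tr x y z'
  tr_smul₃ : ∀ (c : k) (x y z : G), tr x y (c • z) = c • tr x y z
  br_skew : ∀ x y : G, br x y = - br y x
  tr_skew : ∀ x y z : G, tr x y z = - tr y x z
  ly1 : ∀ x y z : G, br (br x y) z + br (br y z) x + br (br z x) y
      + tr x y z + tr y z x + tr z x y = 0
  ly2 : ∀ x y z w : G, tr (br x y) z w + tr (br y z) x w + tr (br z x) y w = 0
  ly3 : ∀ x y z w : G, tr x y (br z w) = br (tr x y z) w + br z (tr x y w)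
  ly4 : ∀ x y z w t : G, tr x y (tr z w t)
      = tr (tr x y z) w t + tr z (tr x y w) t + tr z w (tr x y t)

/-- A representation of a Lie-Yamaguti algebra `(G, br, tr)` on a vector space `V`,
given by linear maps `ρ : G → End(V)` and `μ : G ⊗ G → End(V)`. -/
structure IsLYRep (k G V : Type*) [Field k] [CharZero k]
    [AddCommGroup G] [Module k G] [AddCommGroup V] [Module k V]
    (br : G → G → G) (tr : G → G → G → G)
    (ρ : G → V → V) (μ : G → G → V → V) : Prop where
  ρ_add : ∀ (x y : G) (v : V), ρ (x + y) v = ρ x v + ρ y v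
  ρ_smul : ∀ (c : k) (x : G) (v : V), ρ (c • x) v = c • ρ x v
  ρ_add' : ∀ (x : G) (u v : V), ρ x (u + v) = ρ x u + ρ x v
  ρ_smul' : ∀ (x : G) (c : k) (v : V), ρ x (c • v) = c • ρ x v
  μ_add₁ : ∀ (x x' y : G) (v : V), μ (x + x') y v = μ x y v + μ x' y v
  μ_smul₁ : ∀ (c : k) (x y : G) (v : V), μ (c • x) y v = c • μ x y v
  μ_add₂ : ∀ (x y y' : G) (v : V), μ x (y + y') v = μ x y v + μ x y' v
  μ_smul₂ : ∀ (c : k) (x y : G) (v : V), μ x (c • y) v = c • μ x y v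
  μ_add' : ∀ (x y : G) (u v : V), μ x y (u + v) = μ x y u + μ x y v
  μ_smul' : ∀ (x y : G) (c : k) (v : V), μ x y (c • v) = c • μ x y v
  rep1 : ∀ x y z v, μ (br x y) z v = μ x z (ρ y v) - μ y z (ρ x v)
  rep2 : ∀ x y z v, μ x (br y z) v = ρ y (μ x z v) - ρ z (μ x y v)
  rep3 : ∀ x y z v, ρ (tr x y z) v = Dop br ρ μ x y (ρ z v) - ρ z (Dop br ρ μ x y v)
  rep4 : ∀ x y z w v, μ z w (μ x y v) - μ y w (μ x z v) - μ x (tr y z w) v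
      + Dop br ρ μ y z (μ x w v) = 0
  rep5 : ∀ x y z w v, μ (tr x y z) w v + μ z (tr x y w) v
      = Dop br ρ μ x y (μ z w v) - μ z w (Dop br ρ μ x y v)

/-- A matched pair of Lie-Yamaguti algebras `(G, H, (ρ, μ), (ψ, ν))`. -/
structure IsMatchedPair (k G H : Type*) [Field k] [CharZero k]
    [AddCommGroup G] [Module k G] [AddCommGroup H] [Module k H]
    (brG : G → G → G) (trG : G → G → G → G)
    (brH : H → H → H) (trH : H → H → H → H)
    (ρ : G → H → H) (μ : G → G → H → H)
    (ψ : H → G → G) (ν : H → H → G → G) : Prop where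
  lyG : IsLieYamaguti k G brG trG
  lyH : IsLieYamaguti k H brH trH
  rep_g_on_h : IsLYRep k G H brG trG ρ μ
  rep_h_on_g : IsLYRep k H G brH trH ψ ν
  m1 : ∀ (x : G) (α β : H),
      ρ x (brH α β) = brH (ρ x α) β + brH α (ρ x β) + ρ (ψ β x) α - ρ (ψ α x) β
  m2 : ∀ (x : G) (α β γ : H),
      ρ x (trH α β γ) = trH α β (ρ x γ) - ρ (Dop brH ψ ν α β x) γ
  m3 : ∀ (x : G) (α β γ : H), trH (ρ x α) β γ + trH α (ρ x β) γ = 0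
  m4 : ∀ (x : G) (α β γ : H), ρ (ν α β x) γ = ρ (ν α γ x) β
  m5 : ∀ (x y : G) (α β : H), μ x y (brH α β) = μ (ψ β x) y α - μ (ψ α x) y β
  m6 : ∀ (x y : G) (α β γ : H), μ x y (trH α β γ)
      = trH α β (μ x y γ) - μ (Dop brH ψ ν α β x) y γ - μ x (Dop brH ψ ν α β y) γ
  m7 : ∀ (x y : G) (α β : H), μ x (ψ α y) β = brH α (μ x y β)
  m8 : ∀ (x y : G) (α β γ : H), μ (ν α β x) y γ - μ (ν α γ x) y β
      = μ x (Dop brH ψ ν β γ y) α - trH β γ (μ x y α)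
  m9 : ∀ (x y : G) (α β γ : H), μ x (ν α β y) γ
      = trH (μ x y γ) α β - Dop brG ρ μ y (ν γ α x) β + μ y (ν γ β x) α
  m10 : ∀ (x y : G) (α : H),
      ψ α (brG x y) = brG (ψ α x) y + brG x (ψ α y) + ψ (ρ y α) x - ψ (ρ x α) y
  m11 : ∀ (x y z : G) (α : H),
      ψ α (trG x y z) = trG x y (ψ α z) - ψ (Dop brG ρ μ x y α) z
  m12 : ∀ (x y z : G) (α : H), trG (ψ α x) y z + trG x (ψ α y) z = 0
  m13 : ∀ (x y z : G) (α : H), ψ (μ x y α) z = ψ (μ x z α) y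
  m14 : ∀ (x y : G) (α β : H), ν α β (brG x y) = ν (ρ y α) β x - ν (ρ x α) β y
  m15 : ∀ (x y z : G) (α β : H), ν α β (trG x y z)
      = trG x y (ν α β z) - ν (Dop brG ρ μ x y α) β z - ν α (Dop brG ρ μ x y β) z
  m16 : ∀ (x y : G) (α β : H), ν α (ρ x β) y = brG x (ν α β y)
  m17 : ∀ (x y z : G) (α β : H), ν (μ x y α) β z - ν (μ x z α) β y
      = ν α (Dop brG ρ μ y z β) x - trG y z (ν α β x)
  m18 : ∀ (x y z : G) (α β : H), ν α (μ x y β) z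
      = trG (ν α β z) x y - Dop brH ψ ν β (μ z x α) y + ν β (μ z y α) x

/-- The binary operation of the bicrossed product `G ⋈ H`. -/
def bicrossedBr {G H : Type*} [AddCommGroup G] [AddCommGroup H]
    (brG : G → G → G) (brH : H → H → H)
    (ρ : G → H → H) (ψ : H → G → G) (p q : G × H) : G × H :=
  (brG p.1 q.1 + ψ p.2 q.1 - ψ q.2 p.1, brH p.2 q.2 + ρ p.1 q.2 - ρ q.1 p.2)

/-- The ternary operation of the bicrossed product `G ⋈ H`. -/
def bicrossedTr {G H : Type*} [AddCommGroup G] [AddCommGroup H]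
    (brG : G → G → G) (trG : G → G → G → G)
    (brH : H → H → H) (trH : H → H → H → H)
    (ρ : G → H → H) (μ : G → G → H → H)
    (ψ : H → G → G) (ν : H → H → G → G) (p q s : G × H) : G × H :=
  (trG p.1 q.1 s.1 + Dop brH ψ ν p.2 q.2 s.1 + ν q.2 s.2 p.1 - ν p.2 s.2 q.1,
   trH p.2 q.2 s.2 + Dop brG ρ μ p.1 q.1 s.2 + μ q.1 s.1 p.2 - μ p.1 s.1 q.2)

/-- A deformation map `r : H → G` in a matched pair of Lie-Yamaguti algebras. -/
def IsDeformationMap {G H : Type*} [AddCommGroup G] [AddCommGroup H]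
    (brG : G → G → G) (trG : G → G → G → G)
    (brH : H → H → H) (trH : H → H → H → H)
    (ρ : G → H → H) (μ : G → G → H → H)
    (ψ : H → G → G) (ν : H → H → G → G) (r : H → G) : Prop :=
  (∀ α β : H, brG (r α) (r β) + ψ α (r β) - ψ β (r α)
      = r (brH α β + ρ (r α) β - ρ (r β) α)) ∧
  (∀ α β γ : H, trG (r α) (r β) (r γ) + Dop brH ψ ν α β (r γ)
      + ν β γ (r α) - ν α γ (r β)
      = r (trH α β γ + Dop brG ρ μ (r α) (r β) γ
          + μ (r β) (r γ) α - μ (r α) (r γ) β))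

/-- A left Leibniz algebra `(l, ∘)` gives rise to a Lie-Yamaguti algebra with
`[x,y] := x∘y − y∘x` and `⟦x,y,z⟧ := −(x∘y)∘z`. -/
theorem leibnizAlgebra_isLieYamaguti
    (k L : Type*) [Field k] [CharZero k] [AddCommGroup L] [Module k L]
    (mul : L → L → L)
    (h_add_left : ∀ x y z : L, mul (x + y) z = mul x z + mul y z)
    (h_smul_left : ∀ (c : k) (x y : L), mul (c • x) y = c • mul x y)
    (h_add_right : ∀ x y z : L, mul x (y + z) = mul x y + mul x z)
    (h_smul_right : ∀ (c : k) (x y : L), mul x (c • y) = c • mul x y)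
    (h_leibniz : ∀ x y z : L, mul x (mul y z) = mul (mul x y) z + mul y (mul x z)) :
    IsLieYamaguti k L (fun x y => mul x y - mul y x)
      (fun x y z => -(mul (mul x y) z)) := by
  have h0 : ∀ x y z : L, mul (mul x y) z = mul x (mul y z) - mul y (mul x z) := by
    intro x y z
    rw [h_leibniz x y z]; abel
  have hzl : ∀ x y : L, mul (-x) y = -mul x y := by
    intro x y
    have := h_smul_left (-1) x y
    simpa using this
  have hzr : ∀ x y : L, mul x (-y) = -mul x y := by
    intro x y
    have := h_smul_right (-1) x y
    simpa using this
  have hsl : ∀ x y z : L, mul (x - y) z = mul x z - mul y z := by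
    intro x y z
    rw [sub_eq_add_neg, h_add_left, hzl, sub_eq_add_neg]
  have hsr : ∀ x y z : L, mul x (y - z) = mul x y - mul x z := by
    intro x y z
    rw [sub_eq_add_neg, h_add_right, hzr, sub_eq_add_neg]
  have h4 : ∀ x y z w t : L, -(mul (mul x y) (-(mul (mul z w) t)))
      = -(mul (mul (-(mul (mul x y) z)) w) t) + -(mul (mul z (-(mul (mul x y) w))) t)
        + -(mul (mul z w) (-(mul (mul x y) t))) := by
    intro x y z w t
    generalize mul x y = u
    simp only [hzl, hzr, neg_neg]
    rw [h_leibniz u (mul z w) t, h_leibniz u z w, h_add_left]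
  constructor
  case ly4 => exact h4
  all_goals
    intros
    try simp only [h_add_left, h_add_right, h_smul_left, h_smul_right, hzl, hzr, hsl, hsr, h0,
      smul_sub, smul_neg]
    try abel
end

section
/- Let (g, h, (ρ, μ), (ψ, ν)) and (g, h, (ρ', μ'), (ψ', ν')) be two matched pair structures on the same pair of Lie-Yamaguti algebras g and h, with bicrossed products g ⋈ h and g ⋈' h. (a) If u : g → g and v : h → h are Lie-Yamaguti algebra isomorphisms satisfying v(ρ_x α) = ρ'_{u(x)} v(α), v(μ(x,y)α) = μ'(u(x),u(y)) v(α), u(ψ_α x) = ψ'_{v(α)} u(x), and u(ν(α,β)x) = ν'(v(α),v(β)) u(x) for all x, y ∈ g and α, β ∈ h, then Φ(x,α) := (u(x), v(α)) is a Lie-Yamaguti algebra isomorphism g ⋈ h → g ⋈' h with Φ(g ⊕ 0) ⊆ g ⊕ 0 and Φ(0 ⊕ h) ⊆ 0 ⊕ h. (b) Conversely, every Lie-Yamaguti algebra isomorphism Φ : g ⋈ h → g ⋈' h with Φ(g ⊕ 0) ⊆ g ⊕ 0 and Φ(0 ⊕ h) ⊆ 0 ⊕ h is of this form for a unique such pair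 (u, v). -/
theorem LY_aux_br0 {k G : Type*} [Field k] [CharZero k]
    [AddCommGroup G] [Module k G] {br : G → G → G} {tr : G → G → G → G}
    (h : IsLieYamaguti k G br tr) :
    (∀ x, br 0 x = 0) ∧ (∀ x, br x 0 = 0) ∧ (∀ x y, tr 0 x y = 0) ∧ (∀ x y, tr x 0 y = 0) ∧
    (∀ x y, tr x y 0 = 0) := by
  refine ⟨fun x => ?_, fun x => ?_, fun x y => ?_, fun x y => ?_, fun x y => ?_⟩
  · simpa using h.br_add_left 0 0 x
  · simpa using h.br_add_right x 0 0
  · simpa using h.tr_add₁ 0 0 x y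
  · simpa using h.tr_add₂ x 0 0 y
  · simpa using h.tr_add₃ x y 0 0

theorem LY_aux_rep0 {k G V : Type*} [Field k] [CharZero k]
    [AddCommGroup G] [Module k G] [AddCommGroup V] [Module k V]
    {br : G → G → G} {tr : G → G → G → G} {ρ : G → V → V} {μ : G → G → V → V}
    (h : IsLYRep k G V br tr ρ μ) :
    (∀ x, ρ 0 x = 0) ∧ (∀ x, ρ x 0 = 0) ∧ (∀ x y, μ 0 x y = 0) ∧ (∀ x y, μ x 0 y = 0) ∧
    (∀ x y, μ x y 0 = 0) := by
  refine ⟨fun x => ?_, fun x => ?_, fun x y => ?_, fun x y => ?_, fun x y => ?_⟩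
  · simpa using h.ρ_add 0 0 x
  · simpa using h.ρ_add' x 0 0
  · simpa using h.μ_add₁ 0 0 x y
  · simpa using h.μ_add₂ x 0 0 y
  · simpa using h.μ_add' x y 0 0

/-- Isomorphisms between two bicrossed products `G ⋈ H` and `G ⋈' H`
leaving `G` and `H` invariant correspond exactly to pairs `(u, v)` of Lie-Yamaguti
algebra isomorphisms satisfying the compatibility conditions. -/
theorem bicrossed_iso_correspondence
    (k G H : Type*) [Field k] [CharZero k]
    [AddCommGroup G] [Module k G] [AddCommGroup H] [Module k H]
    (brG : G → G → G) (trG : G → G → G → G)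
    (brH : H → H → H) (trH : H → H → H → H)
    (ρ : G → H → H) (μ : G → G → H → H) (ψ : H → G → G) (ν : H → H → G → G)
    (ρ' : G → H → H) (μ' : G → G → H → H) (ψ' : H → G → G) (ν' : H → H → G → G)
    (hmp : IsMatchedPair k G H brG trG brH trH ρ μ ψ ν)
    (hmp' : IsMatchedPair k G H brG trG brH trH ρ' μ' ψ' ν') :
    -- (a): a compatible pair `(u, v)` of isomorphisms gives an isomorphism
    -- `Φ(x, α) = (u x, v α)` of the bicrossed products preserving `G` and `H`:
    (∀ (u : G → G) (v : H → H),
      (∀ x y : G, u (x + y) = u x + u y) →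
      (∀ (c : k) (x : G), u (c • x) = c • u x) →
      Function.Bijective u →
      (∀ x y : G, u (brG x y) = brG (u x) (u y)) →
      (∀ x y z : G, u (trG x y z) = trG (u x) (u y) (u z)) →
      (∀ α β : H, v (α + β) = v α + v β) →
      (∀ (c : k) (α : H), v (c • α) = c • v α) →
      Function.Bijective v →
      (∀ α β : H, v (brH α β) = brH (v α) (v β)) →
      (∀ α β γ : H, v (trH α β γ) = trH (v α) (v β) (v γ)) →
      (∀ (x : G) (α : H), v (ρ x α) = ρ' (u x) (v α)) →
      (∀ (x y : G) (α : H), v (μ x y α) = μ' (u x) (u y) (v α)) →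
      (∀ (α : H) (x : G), u (ψ α x) = ψ' (v α) (u x)) →
      (∀ (α β : H) (x : G), u (ν α β x) = ν' (v α) (v β) (u x)) →
      (Function.Bijective (fun p : G × H => (u p.1, v p.2)) ∧
       (∀ p q : G × H, (fun p : G × H => (u p.1, v p.2)) (p + q)
          = (fun p : G × H => (u p.1, v p.2)) p + (fun p : G × H => (u p.1, v p.2)) q) ∧
       (∀ (c : k) (p : G × H), (fun p : G × H => (u p.1, v p.2)) (c • p)
          = c • (fun p : G × H => (u p.1, v p.2)) p) ∧
       (∀ p q : G × H, (u (bicrossedBr brG brH ρ ψ p q).1, v (bicrossedBr brG brH ρ ψ p q).2)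
          = bicrossedBr brG brH ρ' ψ' (u p.1, v p.2) (u q.1, v q.2)) ∧
       (∀ p q s : G × H,
          (u (bicrossedTr brG trG brH trH ρ μ ψ ν p q s).1,
           v (bicrossedTr brG trG brH trH ρ μ ψ ν p q s).2)
          = bicrossedTr brG trG brH trH ρ' μ' ψ' ν' (u p.1, v p.2) (u q.1, v q.2) (u s.1, v s.2)) ∧
       (∀ p : G × H, p.2 = 0 → (v p.2 = 0)) ∧
       (∀ p : G × H, p.1 = 0 → (u p.1 = 0)))) ∧
    -- (b): conversely, every such isomorphism `Φ` arises from a unique compatible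
    -- pair `(u, v)`:
    (∀ Φ : G × H → G × H,
      (∀ p q : G × H, Φ (p + q) = Φ p + Φ q) →
      (∀ (c : k) (p : G × H), Φ (c • p) = c • Φ p) →
      Function.Bijective Φ →
      (∀ p q : G × H, Φ (bicrossedBr brG brH ρ ψ p q)
          = bicrossedBr brG brH ρ' ψ' (Φ p) (Φ q)) →
      (∀ p q s : G × H, Φ (bicrossedTr brG trG brH trH ρ μ ψ ν p q s)
          = bicrossedTr brG trG brH trH ρ' μ' ψ' ν' (Φ p) (Φ q) (Φ s)) →
      (∀ x : G, (Φ (x, 0)).2 = 0) →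
      (∀ α : H, (Φ (0, α)).1 = 0) →
      ∃! uv : (G → G) × (H → H),
        (∀ x y : G, uv.1 (x + y) = uv.1 x + uv.1 y) ∧
        (∀ (c : k) (x : G), uv.1 (c • x) = c • uv.1 x) ∧
        Function.Bijective uv.1 ∧
        (∀ x y : G, uv.1 (brG x y) = brG (uv.1 x) (uv.1 y)) ∧
        (∀ x y z : G, uv.1 (trG x y z) = trG (uv.1 x) (uv.1 y) (uv.1 z)) ∧
        (∀ α β : H, uv.2 (α + β) = uv.2 α + uv.2 β) ∧
        (∀ (c : k) (α : H), uv.2 (c • α) = c • uv.2 α) ∧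
        Function.Bijective uv.2 ∧
        (∀ α β : H, uv.2 (brH α β) = brH (uv.2 α) (uv.2 β)) ∧
        (∀ α β γ : H, uv.2 (trH α β γ) = trH (uv.2 α) (uv.2 β) (uv.2 γ)) ∧
        (∀ (x : G) (α : H), uv.2 (ρ x α) = ρ' (uv.1 x) (uv.2 α)) ∧
        (∀ (x y : G) (α : H), uv.2 (μ x y α) = μ' (uv.1 x) (uv.1 y) (uv.2 α)) ∧
        (∀ (α : H) (x : G), uv.1 (ψ α x) = ψ' (uv.2 α) (uv.1 x)) ∧
        (∀ (α β : H) (x : G), uv.1 (ν α β x) = ν' (uv.2 α) (uv.2 β) (uv.1 x)) ∧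
        (∀ p : G × H, Φ p = (uv.1 p.1, uv.2 p.2))) := by
  constructor
  · intro u v ua us ub ubr utr va vs vb vbr vtr hρ hμ hψ hν
    have usub : ∀ x y, u (x - y) = u x - u y := (AddMonoidHom.mk' u ua).map_sub
    have vsub : ∀ x y, v (x - y) = v x - v y := (AddMonoidHom.mk' v va).map_sub
    have u0 : u 0 = 0 := (AddMonoidHom.mk' u ua).map_zero
    have v0 : v 0 = 0 := (AddMonoidHom.mk' v va).map_zero
    refine ⟨ub.prodMap vb, ?_, ?_, ?_, ?_, ?_, ?_⟩
    · intro p q; simp [ua, va]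
    · intro c p; simp [us, vs]
    · intro p q; simp [bicrossedBr, ua, va, usub, vsub, ubr, vbr, hρ, hψ]
    · intro p q s
      simp [bicrossedTr, Dop, ua, va, usub, vsub, ubr, vbr, utr, vtr, hρ, hψ, hμ, hν]
    · intro p hp; rw [hp, v0]
    · intro p hp; rw [hp, u0]
  · intro Φ ha hs hb hbr htr hG hH
    obtain ⟨g1, g2, g3, g4, g5⟩ := LY_aux_br0 hmp.lyG
    obtain ⟨h1, h2, h3, h4, h5⟩ := LY_aux_br0 hmp.lyH
    obtain ⟨r1, r2, r3, r4, r5⟩ := LY_aux_rep0 hmp.rep_g_on_h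
    obtain ⟨s1, s2, s3, s4, s5⟩ := LY_aux_rep0 hmp.rep_h_on_g
    obtain ⟨r1', r2', r3', r4', r5'⟩ := LY_aux_rep0 hmp'.rep_g_on_h
    obtain ⟨s1', s2', s3', s4', s5'⟩ := LY_aux_rep0 hmp'.rep_h_on_g
    obtain ⟨u, hu⟩ : ∃ u : G → G, ∀ x, Φ (x, 0) = (u x, 0) :=
      ⟨fun x => (Φ (x, 0)).1, fun x => Prod.ext rfl (hG x)⟩
    obtain ⟨v, hv⟩ : ∃ v : H → H, ∀ a, Φ (0, a) = (0, v a) :=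
      ⟨fun x => (Φ (0, x)).2, fun x => Prod.ext (hH x) rfl⟩
    have hΦ : ∀ p : G × H, Φ p = (u p.1, v p.2) := by
      rintro ⟨x, a⟩
      have := ha (x, 0) (0, a)
      simpa [hu, hv] using this
    have u0 : u 0 = 0 := by simpa [hu] using congrArg Prod.fst (hv 0)
    have v0 : v 0 = 0 := by simpa [hv] using congrArg Prod.snd (hu 0)
    have hbij : Function.Bijective (Prod.map u v) := by
      have : Prod.map u v = Φ := by funext p; rw [hΦ]; rfl
      rwa [this]
    have hb2 := (Prod.map_bijective).1 hbij
    simp only [hΦ] at ha hs hbr htr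
    refine ⟨(u, v), ⟨?_, ?_, hb2.1, ?_, ?_, ?_, ?_, hb2.2, ?_, ?_, ?_, ?_, ?_, ?_, hΦ⟩, ?_⟩
    · intro x y; simpa using congrArg Prod.fst (ha (x, 0) (y, 0))
    · intro c x; simpa using congrArg Prod.fst (hs c (x, 0))
    · intro x y
      have := congrArg Prod.fst (hbr (x, 0) (y, 0))
      simpa [bicrossedBr, u0, v0, s1, s1'] using this
    · intro x y z
      have := congrArg Prod.fst (htr (x, 0) (y, 0) (z, 0))
      simpa [bicrossedTr, Dop, u0, v0, g1, g2, g3, g4, g5, h1, h2, h3, h4, h5, r1, r2, r3, r4, r5,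
        s1, s2, s3, s4, s5, r1', r2', r3', r4', r5', s1', s2', s3', s4', s5'] using this
    · intro x y; simpa using congrArg Prod.snd (ha (0, x) (0, y))
    · intro c x; simpa using congrArg Prod.snd (hs c (0, x))
    · intro x y
      have := congrArg Prod.snd (hbr (0, x) (0, y))
      simpa [bicrossedBr, u0, v0, r1, r1'] using this
    · intro x y z
      have := congrArg Prod.snd (htr (0, x) (0, y) (0, z))
      simpa [bicrossedTr, Dop, u0, v0, g1, g2, g3, g4, g5, h1, h2, h3, h4, h5, r1, r2, r3, r4, r5,
        s1, s2, s3, s4, s5, r1', r2', r3', r4', r5', s1', s2', s3', s4', s5'] using this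
    · intro x a
      have := congrArg Prod.snd (hbr (x, 0) (0, a))
      simpa [bicrossedBr, u0, v0, r1, r1', h1, r2, r2'] using this
    · intro x y a
      have := congrArg Prod.snd (htr (0, a) (x, 0) (y, 0))
      simpa [bicrossedTr, Dop, u0, v0, g1, g2, g3, g4, g5, h1, h2, h3, h4, h5, r1, r2, r3, r4, r5,
        s1, s2, s3, s4, s5, r1', r2', r3', r4', r5', s1', s2', s3', s4', s5'] using this
    · intro a x
      have := congrArg Prod.fst (hbr (0, a) (x, 0))
      simpa [bicrossedBr, u0, v0, s1, s1', g1, s2, s2'] using this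
    · intro a b x
      have := congrArg Prod.fst (htr (x, 0) (0, a) (0, b))
      simpa [bicrossedTr, Dop, u0, v0, g1, g2, g3, g4, g5, h1, h2, h3, h4, h5, r1, r2, r3, r4, r5,
        s1, s2, s3, s4, s5, r1', r2', r3', r4', r5', s1', s2', s3', s4', s5'] using this
    · rintro ⟨u', v'⟩ ⟨-, -, -, -, -, -, -, -, -, -, -, -, -, -, h⟩
      refine Prod.ext (funext fun x => ?_) (funext fun a => ?_)
      · have := congrArg Prod.fst ((h (x, 0)).symm.trans (hΦ (x, 0)))
        simpa using this
      · have := congrArg Prod.snd ((h (0, a)).symm.trans (hΦ (0, a)))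
        simpa using this
end

section
/- Let (g, h, (ρ, μ), (ψ, ν)) be a matched pair of Lie-Yamaguti algebras with bicrossed product E = g ⋈ h. Let h̄ ⊆ E be a Lie-Yamaguti subalgebra such that E = (g ⊕ 0) + h̄ and (g ⊕ 0) ∩ h̄ = {0}. Then there exists a deformation map r : h → g in the matched pair such that h̄ = Graph(r) = {(r(α), α) : α ∈ h}. -/
/-- Every `g`-complement in the bicrossed product `E = G ⋈ H` is the
graph of a deformation map `r : H → G`. -/
theorem complement_is_graph_of_deformationMap
    (k G H : Type*) [Field k] [CharZero k]
    [AddCommGroup G] [Module k G] [AddCommGroup H] [Module k H]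
    (brG : G → G → G) (trG : G → G → G → G)
    (brH : H → H → H) (trH : H → H → H → H)
    (ρ : G → H → H) (μ : G → G → H → H) (ψ : H → G → G) (ν : H → H → G → G)
    (hmp : IsMatchedPair k G H brG trG brH trH ρ μ ψ ν)
    (S : Set (G × H))
    -- `S` is a Lie-Yamaguti subalgebra of `G ⋈ H`:
    (hS_zero : (0 : G × H) ∈ S)
    (hS_add : ∀ p q : G × H, p ∈ S → q ∈ S → p + q ∈ S)
    (hS_smul : ∀ (c : k) (p : G × H), p ∈ S → c • p ∈ S)
    (hS_br : ∀ p q : G × H, p ∈ S → q ∈ S → bicrossedBr brG brH ρ ψ p q ∈ S)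
    (hS_tr : ∀ p q s : G × H, p ∈ S → q ∈ S → s ∈ S →
        bicrossedTr brG trG brH trH ρ μ ψ ν p q s ∈ S)
    -- `E = (G ⊕ 0) + S`:
    (hsum : ∀ p : G × H, ∃ (x : G) (q : G × H), q ∈ S ∧ p = ((x, 0) : G × H) + q)
    -- `(G ⊕ 0) ∩ S = {0}`:
    (hint : ∀ p : G × H, p ∈ S → p.2 = 0 → p = 0) :
    ∃ r : H → G,
      (∀ α β : H, r (α + β) = r α + r β) ∧
      (∀ (c : k) (α : H), r (c • α) = c • r α) ∧
      IsDeformationMap brG trG brH trH ρ μ ψ ν r ∧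
      S = {p : G × H | p.1 = r p.2} := by
  have hex : ∀ α : H, ∃ x : G, ((x, α) : G × H) ∈ S := by
    intro α
    obtain ⟨x, ⟨a, b⟩, hq, he⟩ := hsum (0, α)
    have h2 : α = b := by simpa using congrArg Prod.snd he
    exact ⟨a, by rw [h2]; exact hq⟩
  choose r hr using hex
  have huniq : ∀ p : G × H, p ∈ S → p.1 = r p.2 := by
    intro p hp
    have h1 := hS_add _ _ hp (hS_smul (-1) _ (hr p.2))
    have h2 := hint _ h1 (by simp)
    have h3 := congrArg Prod.fst h2
    simp only [Prod.fst_add, Prod.smul_fst, neg_smul, one_smul, Prod.fst_zero] at h3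
    exact add_neg_eq_zero.mp h3
  refine ⟨r, ?_, ?_, ⟨?_, ?_⟩, ?_⟩
  · intro α β
    exact (huniq _ (hS_add _ _ (hr α) (hr β))).symm
  · intro c α
    exact (huniq _ (hS_smul c _ (hr α))).symm
  · intro α β
    exact huniq _ (hS_br _ _ (hr α) (hr β))
  · intro α β γ
    exact huniq _ (hS_tr _ _ _ (hr α) (hr β) (hr γ))
  · ext p
    refine ⟨huniq p, fun h => ?_⟩
    have h' : p = (r p.2, p.2) := Prod.ext h rfl
    rw [h']
    exact hr p.2
end

section
/- Let ((g, ⟦·,·,·⟧), (h, ⟦·,·,·⟧'), μ, ν) be a matched pair of Lie triple systems. Define on g ⊕ h the trilinear operation ⟦(x,α),(y,β),(z,γ)⟧_⋈ := (⟦x,y,z⟧ + D_ν(α,β)z + ν(β,γ)x − ν(α,γ)y, ⟦α,β,γ⟧' + D_μ(x,y)γ + μ(y,z)α − μ(x,z)β), where D_μ(x,y) := μ(y,x) − μ(x,y) and D_ν(α,β) := ν(β,α) − ν(α,β). Then (g ⊕ h, ⟦·,·,·⟧_⋈) is a Lie triple system (the bicrossed product of the matched pair). -/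
/-- The operator `D_μ(x,y) = μ(y,x) − μ(x,y)` of a Lie triple system representation. -/
def DopT {G V : Type*} [AddCommGroup V]
    (μ : G → G → V → V) (x y : G) (v : V) : V :=
  μ y x v - μ x y v

/-- A Lie triple system structure on a `k`-vector space `G`, given by a trilinear
ternary bracket `tr`. -/
structure IsLieTriple (k G : Type*) [Field k] [CharZero k]
    [AddCommGroup G] [Module k G] (tr : G → G → G → G) : Prop where
  tr_add₁ : ∀ x x' y z : G, tr (x + x') y z = tr x y z + tr x' y z
  tr_smul₁ : ∀ (c : k) (x y z : G), tr (c • x) y z = c • tr x y z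
  tr_add₂ : ∀ x y y' z : G, tr x (y + y') z = tr x y z + tr x y' z
  tr_smul₂ : ∀ (c : k) (x y z : G), tr x (c • y) z = c • tr x y z
  tr_add₃ : ∀ x y z z' : G, tr x y (z + z') = tr x y z + tr x y z'
  tr_smul₃ : ∀ (c : k) (x y z : G), tr x y (c • z) = c • tr x y z
  tr_skew : ∀ x y z : G, tr x y z = - tr y x z
  cyclic : ∀ x y z : G, tr x y z + tr y z x + tr z x y = 0
  lts : ∀ x y z w t : G, tr x y (tr z w t)
      = tr (tr x y z) w t + tr z (tr x y w) t + tr z w (tr x y t)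

/-- A representation of a Lie triple system `(G, tr)` on a vector space `V`, given by
a linear map `μ : G ⊗ G → End(V)`. -/
structure IsLTSRep (k G V : Type*) [Field k] [CharZero k]
    [AddCommGroup G] [Module k G] [AddCommGroup V] [Module k V]
    (tr : G → G → G → G) (μ : G → G → V → V) : Prop where
  μ_add₁ : ∀ (x x' y : G) (v : V), μ (x + x') y v = μ x y v + μ x' y v
  μ_smul₁ : ∀ (c : k) (x y : G) (v : V), μ (c • x) y v = c • μ x y v
  μ_add₂ : ∀ (x y y' : G) (v : V), μ x (y + y') v = μ x y v + μ x y' v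
  μ_smul₂ : ∀ (c : k) (x y : G) (v : V), μ x (c • y) v = c • μ x y v
  μ_add' : ∀ (x y : G) (u v : V), μ x y (u + v) = μ x y u + μ x y v
  μ_smul' : ∀ (x y : G) (c : k) (v : V), μ x y (c • v) = c • μ x y v
  rep1 : ∀ x y z w v, μ z w (μ x y v) - μ y w (μ x z v) - μ x (tr y z w) v
      + DopT μ y z (μ x w v) = 0
  rep2 : ∀ x y z w v, μ (tr x y z) w v + μ z (tr x y w) v
      = DopT μ x y (μ z w v) - μ z w (DopT μ x y v)

/-- A matched pair of Lie triple systems `((G, tr), (H, tr'), μ, ν)`. -/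
structure IsLTSMatchedPair (k G H : Type*) [Field k] [CharZero k]
    [AddCommGroup G] [Module k G] [AddCommGroup H] [Module k H]
    (trG : G → G → G → G) (trH : H → H → H → H)
    (μ : G → G → H → H) (ν : H → H → G → G) : Prop where
  ltsG : IsLieTriple k G trG
  ltsH : IsLieTriple k H trH
  rep_g_on_h : IsLTSRep k G H trG μ
  rep_h_on_g : IsLTSRep k H G trH ν
  t1 : ∀ (x y : G) (α β γ : H), μ x y (trH α β γ)
      = trH α β (μ x y γ) - μ (DopT ν α β x) y γ - μ x (DopT ν α β y) γ
  t2 : ∀ (x y : G) (α β γ : H), μ (ν α β x) y γ - μ (ν α γ x) y β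
      = μ x (DopT ν β γ y) α - trH β γ (μ x y α)
  t3 : ∀ (x y : G) (α β γ : H), μ x (ν α β y) γ
      = trH (μ x y γ) α β - DopT μ y (ν γ α x) β + μ y (ν γ β x) α
  t4 : ∀ (x y z : G) (α β : H), ν α β (trG x y z)
      = trG x y (ν α β z) - ν (DopT μ x y α) β z - ν α (DopT μ x y β) z
  t5 : ∀ (x y z : G) (α β : H), ν (μ x y α) β z - ν (μ x z α) β y
      = ν α (DopT μ y z β) x - trG y z (ν α β x)
  t6 : ∀ (x y z : G) (α β : H), ν α (μ x y β) z
      = trG (ν α β z) x y - DopT ν β (μ z x α) y + ν β (μ z y α) x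

/-- A deformation map `r : H → G` in a matched pair of Lie triple systems. -/
def IsLTSDeformationMap {G H : Type*} [AddCommGroup G] [AddCommGroup H]
    (trG : G → G → G → G) (trH : H → H → H → H)
    (μ : G → G → H → H) (ν : H → H → G → G) (r : H → G) : Prop :=
  ∀ α β γ : H, trG (r α) (r β) (r γ) + DopT ν α β (r γ)
      + ν β γ (r α) - ν α γ (r β)
    = r (trH α β γ + DopT μ (r α) (r β) γ
        + μ (r β) (r γ) α - μ (r α) (r γ) β)


theorem lts_swap {k G H : Type*} [Field k] [CharZero k]
    [AddCommGroup G] [Module k G] [AddCommGroup H] [Module k H]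
    {trG : G → G → G → G} {trH : H → H → H → H}
    {μ : G → G → H → H} {ν : H → H → G → G}
    (h : IsLTSMatchedPair k G H trG trH μ ν) : IsLTSMatchedPair k H G trH trG ν μ where
  ltsG := h.ltsH
  ltsH := h.ltsG
  rep_g_on_h := h.rep_h_on_g
  rep_h_on_g := h.rep_g_on_h
  t1 := fun x y a b c => h.t4 a b c x y
  t2 := fun x y a b c => h.t5 a b c x y
  t3 := fun x y a b c => h.t6 a b c x y
  t4 := fun x y z a b => h.t1 a b x y z
  t5 := fun x y z a b => h.t2 a b x y z
  t6 := fun x y z a b => h.t3 a b x y z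

theorem map_sub_of_add {A B : Type*} [AddCommGroup A] [AddCommGroup B] (f : A → B)
    (hf : ∀ x y, f (x + y) = f x + f y) (x y : A) : f (x - y) = f x - f y :=
  (AddMonoidHom.mk' f hf).map_sub x y

set_option maxHeartbeats 4000000 in
theorem lts_hcomp {k G H : Type*} [Field k] [CharZero k]
    [AddCommGroup G] [Module k G] [AddCommGroup H] [Module k H]
    {trG : G → G → G → G} {trH : H → H → H → H}
    {μ : G → G → H → H} {ν : H → H → G → G}
    (h : IsLTSMatchedPair k G H trG trH μ ν)
    (fG : G → H → G → H → G → H → G) (fH : G → H → G → H → G → H → H)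
    (hfG : ∀ x a y b z c, fG x a y b z c = trG x y z + DopT ν a b z + ν b c x - ν a c y)
    (hfH : ∀ x a y b z c, fH x a y b z c = trH a b c + DopT μ x y c + μ y z a - μ x z b)
    (x y z w t : G) (a b c d e : H) :
    fH x a y b (fG z c w d t e) (fH z c w d t e)
      = fH (fG x a y b z c) (fH x a y b z c) w d t e
      + fH z c (fG x a y b w d) (fH x a y b w d) t e
      + fH z c w d (fG x a y b t e) (fH x a y b t e) := by
  have hH := h.ltsH
  have rG := h.rep_g_on_h
  have s1 := fun p q y z => map_sub_of_add (fun x => trH x y z) (fun x x' => hH.tr_add₁ x x' y z) p q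
  have s2 := fun p q x z => map_sub_of_add (fun y => trH x y z) (fun y y' => hH.tr_add₂ x y y' z) p q
  have s3 := fun p q x y => map_sub_of_add (fun z => trH x y z) (fun z z' => hH.tr_add₃ x y z z') p q
  have m1 := fun p q y v => map_sub_of_add (fun x => μ x y v) (fun x x' => rG.μ_add₁ x x' y v) p q
  have m2 := fun p q x v => map_sub_of_add (fun y => μ x y v) (fun y y' => rG.μ_add₂ x y y' v) p q
  have m3 := fun p q x y => map_sub_of_add (fun v => μ x y v) (fun u v => rG.μ_add' x y u v) p q
  have e1 := hH.lts a b c d e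
  have e2 := rG.rep1 y z w t a
  have e3 := rG.rep1 x z w t b
  have e4 := rG.rep2 x y w t c
  have e5 := rG.rep2 x y z t d
  have e6 := rG.rep2 x y z w e
  have e7 := rG.rep2 x y w z e
  have e8 := h.t1 w t a b c
  have e9 := h.t1 z t a b d
  have e10 := h.t1 w z a b e
  have e11 := h.t1 z w a b e
  have e12 := h.t2 y t a c d
  have e13 := hH.tr_skew (μ y w a) c e
  have e14 := h.t3 y w c e a
  have e15 := h.t3 y z d e a
  have e16 := h.t2 x t b c d
  have e17 := hH.tr_skew (μ x w b) c e
  have e18 := h.t3 x w c e b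
  have e19 := h.t3 x z d e b
  have e20 := h.t1 y x c d e
  have e21 := h.t1 x y c d e
  have e22 := h.t3 y x d e c
  have e23 := h.t3 x y d e c
  have e24 := hH.tr_skew (μ y x d) c e
  have e25 := h.t3 y x c e d
  have e26 := hH.tr_skew (μ x y d) c e
  have e27 := h.t3 x y c e d
  linear_combination (norm := skip) e1 - e2 + e3 - e4 + e5 + e6 - e7 - e8 + e9 - e10 + e11 - e12
    - e13 - e14 + e15 + e16 + e17 + e18 - e19 + e20 - e21 + e22 - e23 - e24 - e25 + e26 + e27
  clear e1 e2 e3 e4 e5 e6 e7 e8 e9 e10 e11 e12 e13 e14 e15 e16 e17 e18 e19 e20 e21 e22 e23 e24 e25 e26 e27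
  simp only [hfG, hfH, DopT, s1, s2, s3, m1, m2, m3, hH.tr_add₁, hH.tr_add₂, hH.tr_add₃,
    rG.μ_add₁, rG.μ_add₂, rG.μ_add']
  abel

/-- The bicrossed product of a matched pair of Lie triple systems is a
Lie triple system. -/
theorem ltsBicrossedProduct_isLieTriple
    (k G H : Type*) [Field k] [CharZero k]
    [AddCommGroup G] [Module k G] [AddCommGroup H] [Module k H]
    (trG : G → G → G → G) (trH : H → H → H → H)
    (μ : G → G → H → H) (ν : H → H → G → G)
    (hmp : IsLTSMatchedPair k G H trG trH μ ν) :
    IsLieTriple k (G × H)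
      (fun p q s =>
        (trG p.1 q.1 s.1 + DopT ν p.2 q.2 s.1 + ν q.2 s.2 p.1 - ν p.2 s.2 q.1,
         trH p.2 q.2 s.2 + DopT μ p.1 q.1 s.2 + μ q.1 s.1 p.2 - μ p.1 s.1 q.2)) := by
  have hG := hmp.ltsG
  have hH := hmp.ltsH
  have rG := hmp.rep_g_on_h
  have rH := hmp.rep_h_on_g
  constructor
  case lts =>
    intro p q r s u
    refine Prod.ext ?_ ?_
    · exact lts_hcomp (lts_swap hmp)
        (fun a x b y c z => trH a b c + DopT μ x y c + μ y z a - μ x z b)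
        (fun a x b y c z => trG x y z + DopT ν a b z + ν b c x - ν a c y)
        (fun _ _ _ _ _ _ => rfl) (fun _ _ _ _ _ _ => rfl)
        p.2 q.2 r.2 s.2 u.2 p.1 q.1 r.1 s.1 u.1
    · exact lts_hcomp hmp
        (fun x a y b z c => trG x y z + DopT ν a b z + ν b c x - ν a c y)
        (fun x a y b z c => trH a b c + DopT μ x y c + μ y z a - μ x z b)
        (fun _ _ _ _ _ _ => rfl) (fun _ _ _ _ _ _ => rfl)
        p.1 q.1 r.1 s.1 u.1 p.2 q.2 r.2 s.2 u.2
  case tr_skew =>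
    intro p q s
    refine Prod.ext ?_ ?_
    · have := hG.tr_skew p.1 q.1 s.1
      simp only [DopT, Prod.fst_neg, this]
      abel
    · have := hH.tr_skew p.2 q.2 s.2
      simp only [DopT, Prod.snd_neg, this]
      abel
  case cyclic =>
    intro p q s
    refine Prod.ext ?_ ?_
    · have := hG.cyclic p.1 q.1 s.1
      simp only [DopT, Prod.fst_add, Prod.fst_zero]
      rw [← this]
      abel
    · have := hH.cyclic p.2 q.2 s.2
      simp only [DopT, Prod.snd_add, Prod.snd_zero]
      rw [← this]
      abel
  all_goals
    intros
    refine Prod.ext ?_ ?_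
    all_goals
      simp only [DopT, Prod.fst_add, Prod.snd_add, Prod.smul_fst, Prod.smul_snd,
        hG.tr_add₁, hG.tr_add₂, hG.tr_add₃, hG.tr_smul₁, hG.tr_smul₂, hG.tr_smul₃,
        hH.tr_add₁, hH.tr_add₂, hH.tr_add₃, hH.tr_smul₁, hH.tr_smul₂, hH.tr_smul₃,
        rG.μ_add₁, rG.μ_add₂, rG.μ_add', rG.μ_smul₁, rG.μ_smul₂, rG.μ_smul',
        rH.μ_add₁, rH.μ_add₂, rH.μ_add', rH.μ_smul₁, rH.μ_smul₂, rH.μ_smul']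
      module
end

section
/- Let ((g, ⟦·,·,·⟧), (h, ⟦·,·,·⟧'), μ, ν) be a matched pair of Lie triple systems and let r : h → g be a deformation map. Then: (i) the operation ⟦α,β,γ⟧'_r := ⟦α,β,γ⟧' + D_μ(r(α),r(β))γ + μ(r(β),r(γ))α − μ(r(α),r(γ))β makes (h, ⟦·,·,·⟧'_r) a Lie triple system; and (ii) the linear map ν_r : h ⊗ h → End(g) defined by ν_r(α,β)x := ν(α,β)x + ⟦x, r(α), r(β)⟧ − r(D_μ(x, r(α))β − μ(x, r(β))α) makes (g; ν_r) a representation of the Lie triple system (h, ⟦·,·,·⟧'_r). -/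
set_option linter.unusedSimpArgs false

theorem aux_sub {A B : Type*} [AddCommGroup A] [AddCommGroup B] (f : A → B)
    (h : ∀ a b, f (a + b) = f a + f b) (a b : A) : f (a - b) = f a - f b :=
  map_sub (AddMonoidHom.mk' f h) a b

theorem aux_zero {A B : Type*} [AddCommGroup A] [AddCommGroup B] (f : A → B)
    (h : ∀ a b, f (a + b) = f a + f b) : f 0 = 0 :=
  map_zero (AddMonoidHom.mk' f h)

theorem aux_neg {A B : Type*} [AddCommGroup A] [AddCommGroup B] (f : A → B)
    (h : ∀ a b, f (a + b) = f a + f b) (a : A) : f (-a) = - f a :=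
  map_neg (AddMonoidHom.mk' f h) a

theorem IsLTSMatchedPair.swap {k G H : Type*} [Field k] [CharZero k]
    [AddCommGroup G] [Module k G] [AddCommGroup H] [Module k H]
    {trG : G → G → G → G} {trH : H → H → H → H}
    {μ : G → G → H → H} {ν : H → H → G → G}
    (hmp : IsLTSMatchedPair k G H trG trH μ ν) :
    IsLTSMatchedPair k H G trH trG ν μ :=
  ⟨hmp.ltsH, hmp.ltsG, hmp.rep_h_on_g, hmp.rep_g_on_h,
    fun x y α β γ => hmp.t4 α β γ x y, fun x y α β γ => hmp.t5 α β γ x y,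
    fun x y α β γ => hmp.t6 α β γ x y, fun x y z α β => hmp.t1 α β x y z,
    fun x y z α β => hmp.t2 α β x y z, fun x y z α β => hmp.t3 α β x y z⟩

/-- one component of the bracket on the bicrossed product -/
def bic {G H : Type*} [AddCommGroup G] (trG : G → G → G → G) (ν : H → H → G → G)
    (x : G) (a : H) (y : G) (b : H) (z : G) (c : H) : G :=
  trG x y z + DopT ν a b z + ν b c x - ν a c y

theorem bic_lts {k G H : Type*} [Field k] [CharZero k]
    [AddCommGroup G] [Module k G] [AddCommGroup H] [Module k H]
    {trG : G → G → G → G} {trH : H → H → H → H}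
    {μ : G → G → H → H} {ν : H → H → G → G}
    (hmp : IsLTSMatchedPair k G H trG trH μ ν) (x y z w t : G) (a b c d e : H) :
    bic trG ν x a y b (bic trG ν z c w d t e) (bic trH μ c z d w e t)
    = bic trG ν (bic trG ν x a y b z c) (bic trH μ a x b y c z) w d t e
    + bic trG ν z c (bic trG ν x a y b w d) (bic trH μ a x b y d w) t e
    + bic trG ν z c w d (bic trG ν x a y b t e) (bic trH μ a x b y e t) := by
  obtain ⟨G1, -, G2, -, G3, -, sk, cy, lt⟩ := hmp.ltsG
  obtain ⟨N1, -, N2, -, N3, -, n1, n2⟩ := hmp.rep_h_on_g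
  obtain ⟨M1, -, M2, -, M3, -, -, -⟩ := hmp.rep_g_on_h
  have hsk := hmp.ltsH.tr_skew
  have t4 := hmp.t4
  have t5 := hmp.t5
  have t6 := hmp.t6
  have G1s : ∀ x x' y z, trG (x - x') y z = trG x y z - trG x' y z :=
    fun x x' y z => aux_sub (fun x => trG x y z) (fun a b => G1 a b y z) x x'
  have G2s : ∀ x y y' z, trG x (y - y') z = trG x y z - trG x y' z :=
    fun x y y' z => aux_sub (fun y => trG x y z) (fun a b => G2 x a b z) y y'
  have G3s : ∀ x y z z', trG x y (z - z') = trG x y z - trG x y z' :=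
    fun x y z z' => aux_sub (fun z => trG x y z) (fun a b => G3 x y a b) z z'
  have N1s : ∀ x x' y z, ν (x - x') y z = ν x y z - ν x' y z :=
    fun x x' y z => aux_sub (fun x => ν x y z) (fun a b => N1 a b y z) x x'
  have N2s : ∀ x y y' z, ν x (y - y') z = ν x y z - ν x y' z :=
    fun x y y' z => aux_sub (fun y => ν x y z) (fun a b => N2 x a b z) y y'
  have N3s : ∀ x y z z', ν x y (z - z') = ν x y z - ν x y z' :=
    fun x y z z' => aux_sub (fun z => ν x y z) (fun a b => N3 x y a b) z z'
  clear hmp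
  simp only [DopT, N1s, N2s, N3s] at n1 n2 t4 t5 t6
  have h12 := fun a b z w t => show ν b a (trG z w t) - ν a b (trG z w t)
    = trG (ν b a z - ν a b z) w t + trG z (ν b a w - ν a b w) t + trG z w (ν b a t - ν a b t) by
      simp only [G1s, G2s, G3s]
      linear_combination (norm := skip) t4 z w t b a - t4 z w t a b
        - t6 w t z a b - t6 z t w b a + t6 z t w a b + t6 w t z b a
        + sk z (ν a b w) t - sk z (ν b a w) t
      abel
  simp only [bic, DopT, G1, G2, G3, N1, N2, N3, G1s, G2s, G3s, N1s, N2s, N3s]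
  have h12' := h12 a b z w t
  simp only [G1s, G2s, G3s] at h12'
  linear_combination (norm := skip) lt x y z w t + h12'
    - t4 x y t d c + t4 x y t c d - t4 x y z d e + t4 x y w c e
    - t6 w t y a c + t6 z t y a d + sk z (ν a d y) t
    + t6 w t x b c - t6 z t x b d - sk z (ν b d x) t
    + t5 y z w a e - t5 x z w b e
    - n2 a b d c t + n2 a b c d t - n2 a b d e z + n2 a b c e w
    - n1 b c d e x + n1 a c d e y
  abel

/-- the bracket on the bicrossed product -/
def bicT {G H : Type*} [AddCommGroup G] [AddCommGroup H] (trG : G → G → G → G)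
    (trH : H → H → H → H) (μ : G → G → H → H) (ν : H → H → G → G) (p q s : G × H) : G × H :=
  (bic trG ν p.1 p.2 q.1 q.2 s.1 s.2, bic trH μ p.2 p.1 q.2 q.1 s.2 s.1)

theorem bic_lin {k G H : Type*} [Field k] [CharZero k]
    [AddCommGroup G] [Module k G] [AddCommGroup H] [Module k H]
    {trG : G → G → G → G} {trH : H → H → H → H}
    {μ : G → G → H → H} {ν : H → H → G → G}
    (hmp : IsLTSMatchedPair k G H trG trH μ ν) :
    (∀ x a x' a' y b z c, bic trG ν (x + x') (a + a') y b z c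
      = bic trG ν x a y b z c + bic trG ν x' a' y b z c) ∧
    (∀ (m : k) x a y b z c, bic trG ν (m • x) (m • a) y b z c = m • bic trG ν x a y b z c) ∧
    (∀ x a y b y' b' z c, bic trG ν x a (y + y') (b + b') z c
      = bic trG ν x a y b z c + bic trG ν x a y' b' z c) ∧
    (∀ (m : k) x a y b z c, bic trG ν x a (m • y) (m • b) z c = m • bic trG ν x a y b z c) ∧
    (∀ x a y b z c z' c', bic trG ν x a y b (z + z') (c + c')
      = bic trG ν x a y b z c + bic trG ν x a y b z' c') ∧
    (∀ (m : k) x a y b z c, bic trG ν x a y b (m • z) (m • c) = m • bic trG ν x a y b z c) ∧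
    (∀ x a y b z c, bic trG ν x a y b z c = - bic trG ν y b x a z c) ∧
    (∀ x a y b z c, bic trG ν x a y b z c + bic trG ν y b z c x a + bic trG ν z c x a y b = 0)
    := by
  obtain ⟨G1, G1', G2, G2', G3, G3', sk, cy, lt⟩ := hmp.ltsG
  obtain ⟨N1, N1', N2, N2', N3, N3', n1, n2⟩ := hmp.rep_h_on_g
  refine ⟨?_, ?_, ?_, ?_, ?_, ?_, ?_, ?_⟩ <;> intros <;>
    simp only [bic, DopT, G1, G1', G2, G2', G3, G3', N1, N1', N2, N2', N3, N3']
  · abel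
  · simp only [smul_add, smul_sub]
  · abel
  · simp only [smul_add, smul_sub]
  · abel
  · simp only [smul_add, smul_sub]
  · rename_i x a y b z c
    rw [sk x y z]; abel
  · rename_i x a y b z c
    linear_combination (norm := skip) cy x y z
    abel

theorem bicT_lts {k G H : Type*} [Field k] [CharZero k]
    [AddCommGroup G] [Module k G] [AddCommGroup H] [Module k H]
    {trG : G → G → G → G} {trH : H → H → H → H}
    {μ : G → G → H → H} {ν : H → H → G → G}
    (hmp : IsLTSMatchedPair k G H trG trH μ ν) :
    IsLieTriple k (G × H) (bicT trG trH μ ν) := by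
  obtain ⟨g1, g2, g3, g4, g5, g6, g7, g8⟩ := bic_lin hmp
  obtain ⟨h1, h2, h3, h4, h5, h6, h7, h8⟩ := bic_lin hmp.swap
  exact ⟨fun _ _ _ _ => Prod.ext (g1 ..) (h1 ..), fun _ _ _ _ => Prod.ext (g2 ..) (h2 ..),
    fun _ _ _ _ => Prod.ext (g3 ..) (h3 ..), fun _ _ _ _ => Prod.ext (g4 ..) (h4 ..),
    fun _ _ _ _ => Prod.ext (g5 ..) (h5 ..), fun _ _ _ _ => Prod.ext (g6 ..) (h6 ..),
    fun _ _ _ => Prod.ext (g7 ..) (h7 ..), fun _ _ _ => Prod.ext (g8 ..) (h8 ..),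
    fun _ _ _ _ _ => Prod.ext (bic_lts hmp ..) (bic_lts hmp.swap ..)⟩

/-- a subsystem of a Lie triple system -/
theorem sub_lts {k E H : Type*} [Field k] [CharZero k]
    [AddCommGroup E] [Module k E] [AddCommGroup H] [Module k H]
    {T : E → E → E → E} (hT : IsLieTriple k E T) (φ : H →ₗ[k] E) (hφ : Function.Injective φ)
    (S : H → H → H → H) (hS : ∀ a b c, φ (S a b c) = T (φ a) (φ b) (φ c)) :
    IsLieTriple k H S := by
  obtain ⟨G1, G1', G2, G2', G3, G3', sk, cy, lt⟩ := hT
  refine ⟨?_, ?_, ?_, ?_, ?_, ?_, ?_, ?_, ?_⟩ <;> intros <;> apply hφ <;>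
    simp only [hS, map_add, map_smul, map_neg, map_zero, G1, G1', G2, G2', G3, G3']
  · exact sk ..
  · exact cy ..
  · exact lt ..

/-- the quotient representation by a subsystem -/
theorem quot_rep {k E H G : Type*} [Field k] [CharZero k]
    [AddCommGroup E] [Module k E] [AddCommGroup H] [Module k H] [AddCommGroup G] [Module k G]
    {T : E → E → E → E} (hT : IsLieTriple k E T) (φ : H →ₗ[k] E)
    (S : H → H → H → H) (hS : ∀ a b c, φ (S a b c) = T (φ a) (φ b) (φ c))
    (ι : G →ₗ[k] E) (π : E →ₗ[k] G) (q : E →ₗ[k] H) (hd : ∀ v, v = ι (π v) + φ (q v))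
    (hπ : ∀ a, π (φ a) = 0) (hπι : ∀ x, π (ι x) = x)
    (ρ : H → H → G → G) (hρ : ∀ a b x, ρ a b x = π (T (ι x) (φ a) (φ b))) :
    IsLTSRep k H G S ρ := by
  obtain ⟨G1, G1', G2, G2', G3, G3', sk, cy, lt⟩ := hT
  have key : ∀ a b v, ρ a b (π v) = π (T v (φ a) (φ b)) := by
    intro a b v
    conv_rhs => rw [hd v]
    rw [G1, map_add, ← hS, hπ, add_zero, hρ]
  have hD : ∀ a b v, DopT ρ a b (π v) = π (T (φ a) (φ b) v) := by
    intro a b v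
    rw [DopT, key, key, ← map_sub]
    congr 1
    linear_combination (norm := skip) cy v (φ b) (φ a) - sk (φ a) v (φ b) - sk (φ a) (φ b) v
    abel
  refine ⟨?_, ?_, ?_, ?_, ?_, ?_, ?_, ?_⟩
  · intros; simp only [hρ, map_add, map_smul, G1, G1', G2, G2', G3, G3']
  · intros; simp only [hρ, map_add, map_smul, G1, G1', G2, G2', G3, G3']
  · intros; simp only [hρ, map_add, map_smul, G1, G1', G2, G2', G3, G3']
  · intros; simp only [hρ, map_add, map_smul, G1, G1', G2, G2', G3, G3']
  · intros; simp only [hρ, map_add, map_smul, G1, G1', G2, G2', G3, G3']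
  · intros; simp only [hρ, map_add, map_smul, G1, G1', G2, G2', G3, G3']
  · intro x y z w v
    rw [← hπι v]
    generalize ι v = v
    simp only [key, hD, hS, ← map_sub, ← map_add]
    rw [← map_zero π]
    congr 1
    linear_combination (norm := skip) - lt v (φ x) (φ y) (φ z) (φ w)
      - sk (φ y) (T v (φ x) (φ z)) (φ w)
    abel
  · intro x y z w v
    rw [← hπι v]
    generalize ι v = v
    simp only [key, hD, hS, ← map_sub, ← map_add]
    congr 1
    linear_combination (norm := skip) - lt (φ x) (φ y) v (φ z) (φ w)
    abel

/-- A deformation map `r` in a matched pair of Lie triple systems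
induces a Lie triple system structure on `H`, and `ν_r` makes `G` a representation
of the induced Lie triple system. -/
theorem ltsDeformationMap_induced
    (k G H : Type*) [Field k] [CharZero k]
    [AddCommGroup G] [Module k G] [AddCommGroup H] [Module k H]
    (trG : G → G → G → G) (trH : H → H → H → H)
    (μ : G → G → H → H) (ν : H → H → G → G)
    (hmp : IsLTSMatchedPair k G H trG trH μ ν)
    (r : H → G)
    (hr_add : ∀ α β : H, r (α + β) = r α + r β)
    (hr_smul : ∀ (c : k) (α : H), r (c • α) = c • r α)
    (hdef : IsLTSDeformationMap trG trH μ ν r) :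
    IsLieTriple k H
      (fun α β γ => trH α β γ + DopT μ (r α) (r β) γ
        + μ (r β) (r γ) α - μ (r α) (r γ) β) ∧
    IsLTSRep k H G
      (fun α β γ => trH α β γ + DopT μ (r α) (r β) γ
        + μ (r β) (r γ) α - μ (r α) (r γ) β)
      (fun α β x => ν α β x + trG x (r α) (r β)
        - r (DopT μ x (r α) β - μ x (r β) α)) := by
  have hT := bicT_lts hmp
  let rl : H →ₗ[k] G := { toFun := r, map_add' := hr_add, map_smul' := hr_smul }
  let φ : H →ₗ[k] G × H := LinearMap.prod rl LinearMap.id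
  have hS : ∀ a b c, φ (trH a b c + DopT μ (r a) (r b) c
        + μ (r b) (r c) a - μ (r a) (r c) b) = bicT trG trH μ ν (φ a) (φ b) (φ c) :=
    fun a b c => Prod.ext (hdef a b c).symm rfl
  refine ⟨sub_lts hT φ (fun a b h => congrArg Prod.snd h) _ hS,
    quot_rep hT φ _ hS (LinearMap.inl k G H)
      (LinearMap.fst k G H - rl.comp (LinearMap.snd k G H)) (LinearMap.snd k G H) ?_ ?_ ?_ _ ?_⟩
  · intro v
    ext <;> simp [φ]
  · intro a
    simp [φ]
  · intro x
    simp
  · intro a b x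
    obtain ⟨M1, -, M2, -, M3, -, -, -⟩ := hmp.rep_g_on_h
    obtain ⟨N1, -, N2, -, N3, -, -, -⟩ := hmp.rep_h_on_g
    obtain ⟨P1, -, -, -, -, -, -, -, -⟩ := hmp.ltsH
    have e1 : ∀ y z, μ y z 0 = 0 := fun y z => aux_zero (fun v => μ y z v) (M3 y z)
    have e2 : ∀ y z, ν 0 y z = 0 := fun y z => aux_zero (fun v => ν v y z) (fun a b => N1 a b y z)
    have e3 : ∀ y z, ν y 0 z = 0 := fun y z => aux_zero (fun v => ν y v z) (fun a b => N2 y a b z)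
    have e4 : ∀ y z, trH 0 y z = 0 :=
      fun y z => aux_zero (fun v => trH v y z) (fun a b => P1 a b y z)
    have h1 : (bicT trG trH μ ν (LinearMap.inl k G H x) (φ a) (φ b)).1
        = ν a b x + trG x (r a) (r b) := by
      change bic trG ν x 0 (r a) a (r b) b = _
      simp only [bic, DopT, e2, e3]; abel
    have h2 : (bicT trG trH μ ν (LinearMap.inl k G H x) (φ a) (φ b)).2
        = DopT μ x (r a) b - μ x (r b) a := by
      change bic trH μ 0 x a (r a) b (r b) = _
      simp only [bic, e1, e4]; abel
    change _ = (bicT trG trH μ ν (LinearMap.inl k G H x) (φ a) (φ b)).1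
      - r (bicT trG trH μ ν (LinearMap.inl k G H x) (φ a) (φ b)).2
    rw [h1, h2]
end
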